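/- arXiv:2009.11206 — 4 statements merged into one kernel-verified Lean document; each statement's English description precedes it below -/
import Mathlib

section
/- Let n ≥ 1 be an integer, let N ≥ 1, and let μ be a measure on Euclidean space ℝ^N that is finite on bounded sets and satisfies μ(B_r(0)) = rⁿ · μ(B_1(0)) for every r > 0 (dilation-invariance of degree n), with μ(B_1(0)) < ∞. Then (4π)^{-n/2} ∫_{ℝ^N} e^{-|x|²/4} dμ(x) = μ(B_1(0)) · Γ(n/2 + 1) / π^{n/2}. In particular, the Gaussian area (4π)^{-n/2} ∫ e^{-|x|²/4} dμ equals the n-dimensional density μ(B_1(0))/ω_n of μ at the origin, where ω_n = π^{n/2}/Γ(n/2+1) is the volume of the unit ball in ℝⁿ. -/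
open Real MeasureTheory Metric

theorem aux_tail (c : ℝ) : ∫⁻ s in Set.Ioi c, ENNReal.ofReal (Real.exp (-(1/4) * s) / 4)
    = ENNReal.ofReal (Real.exp (-c / 4)) := by
  rw [← ofReal_integral_eq_lintegral_ofReal]
  · rw [integral_div, integral_exp_mul_Ioi (by norm_num)]
    congr 1
    rw [show -(1/4) * c = -c/4 by ring]
    ring
  · exact (integrableOn_exp_mul_Ioi (by norm_num) c).div_const 4
  · exact Filter.Eventually.of_forall fun s => by positivity

theorem aux_gamma (n : ℕ) :
    ∫⁻ s in Set.Ioi (0:ℝ), ENNReal.ofReal (Real.exp (-(1/4) * s) / 4 * (√s) ^ n)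
    = ENNReal.ofReal (4 ^ ((n:ℝ)/2) * Real.Gamma ((n : ℝ) / 2 + 1)) := by
  have h := Real.integral_rpow_mul_exp_neg_mul_Ioi (a := (n:ℝ)/2+1) (r := 1/4)
    (by positivity) (by norm_num)
  have hpos : (0:ℝ) < (1 / (1/4)) ^ ((n:ℝ)/2+1) * Real.Gamma ((n:ℝ)/2+1) :=
    mul_pos (by positivity) (Real.Gamma_pos_of_pos (by positivity))
  have hint : IntegrableOn (fun t : ℝ => t ^ ((n:ℝ)/2+1-1) * Real.exp (-(1/4*t))) (Set.Ioi 0) := by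
    by_contra hc
    have := integral_undef hc
    rw [h] at this
    exact hpos.ne' this
  have he : Set.EqOn (fun s : ℝ => Real.exp (-(1/4) * s) / 4 * (√s) ^ n)
      (fun t : ℝ => (t ^ ((n:ℝ)/2+1-1) * Real.exp (-(1/4*t))) / 4) (Set.Ioi 0) := by
    intro s hs
    have hs : 0 < s := hs
    simp only
    rw [Real.sqrt_eq_rpow, ← Real.rpow_natCast, ← Real.rpow_mul hs.le,
      show (1/2 * (n:ℝ)) = (n:ℝ)/2+1-1 by ring, neg_mul]
    ring
  rw [← ofReal_integral_eq_lintegral_ofReal]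
  · rw [setIntegral_congr_fun measurableSet_Ioi he, integral_div, h]
    congr 1
    rw [show (1 / (1/4) : ℝ) = 4 by norm_num, Real.rpow_add_one (by norm_num)]
    ring
  · exact (integrableOn_congr_fun he measurableSet_Ioi).2 (hint.div_const 4)
  · exact Filter.Eventually.of_forall fun s => by positivity

/-- If `μ` is a measure on `ℝ^N` that is finite on balls and dilation-invariant of
degree `n` (i.e. `μ(B_r(0)) = rⁿ · μ(B_1(0))` for all `r > 0`), then the Gaussian area
`(4π)^(-n/2) ∫ e^(-|x|²/4) dμ` equals the density `μ(B_1(0)) · Γ(n/2+1) / π^(n/2)`. -/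
theorem stmt_1 (n N : ℕ) (hn : 1 ≤ n) (hN : 1 ≤ N)
    (μ : Measure (EuclideanSpace ℝ (Fin N)))
    (hfin : ∀ r : ℝ, 0 < r → μ (ball 0 r) ≠ ⊤)
    (hdil : ∀ r : ℝ, 0 < r →
      μ (ball 0 r) = ENNReal.ofReal (r ^ n) * μ (ball 0 1)) :
    (4 * π) ^ (-(n : ℝ) / 2) * ∫ x, Real.exp (-‖x‖ ^ 2 / 4) ∂μ
      = (μ (ball 0 1)).toReal * Real.Gamma ((n : ℝ) / 2 + 1) / π ^ ((n : ℝ) / 2) := by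
  have : IsLocallyFiniteMeasure μ := ⟨fun x => ⟨ball 0 (‖x‖ + 1),
    isOpen_ball.mem_nhds (by simp), (hfin _ (by positivity)).lt_top⟩⟩
  have key : ∫⁻ x, ENNReal.ofReal (Real.exp (-‖x‖ ^ 2 / 4)) ∂μ
      = ENNReal.ofReal (4 ^ ((n:ℝ)/2) * Real.Gamma ((n : ℝ) / 2 + 1)) * μ (ball 0 1) := by
    let S : Set (EuclideanSpace ℝ (Fin N) × ℝ) := {p | ‖p.1‖ ^ 2 < p.2}
    have hS : MeasurableSet S := measurableSet_lt (by fun_prop) (by fun_prop)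
    let F : EuclideanSpace ℝ (Fin N) × ℝ → ENNReal :=
      S.indicator (fun p => ENNReal.ofReal (Real.exp (-(1/4) * p.2) / 4))
    have hF : Measurable F := Measurable.indicator (by fun_prop) hS
    have h1 : ∀ x, ∫⁻ s, F (x, s) = ENNReal.ofReal (Real.exp (-‖x‖ ^ 2 / 4)) := by
      intro x
      rw [← aux_tail, ← lintegral_indicator measurableSet_Ioi]
      rfl
    have h2 : ∀ s, ∫⁻ x, F (x, s) ∂μ = (Set.Ioi (0:ℝ)).indicator (fun s =>
        ENNReal.ofReal (Real.exp (-(1/4) * s) / 4 * (√s) ^ n) * μ (ball 0 1)) s := by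
      intro s
      by_cases hs : 0 < s
      · rw [Set.indicator_of_mem (show s ∈ Set.Ioi 0 from hs)]
        have : ∀ x, F (x, s) = (ball (0 : EuclideanSpace ℝ (Fin N)) (√s)).indicator
            (fun _ => ENNReal.ofReal (Real.exp (-(1/4) * s) / 4)) x := by
          intro x
          have hiff : (x, s) ∈ S ↔ x ∈ ball (0 : EuclideanSpace ℝ (Fin N)) (√s) := by
            rw [mem_ball_zero_iff, Real.lt_sqrt (norm_nonneg _)]
            rfl
          by_cases hx : (x, s) ∈ S
          · simp only [F]
            rw [Set.indicator_of_mem hx, Set.indicator_of_mem (hiff.1 hx)]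
          · simp only [F]
            rw [Set.indicator_of_notMem hx, Set.indicator_of_notMem (fun h => hx (hiff.2 h))]
        simp_rw [this]
        rw [lintegral_indicator_const measurableSet_ball, hdil _ (Real.sqrt_pos.2 hs),
          ENNReal.ofReal_mul (by positivity), mul_assoc]
      · rw [Set.indicator_of_notMem (show s ∉ Set.Ioi 0 from hs)]
        have : ∀ x, F (x, s) = 0 := fun x => Set.indicator_of_notMem
          (show (x, s) ∉ S from fun h => hs ((sq_nonneg ‖x‖).trans_lt h)) _
        simp [this]
    simp_rw [← h1]
    rw [lintegral_lintegral_swap (by exact hF.aemeasurable)]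
    simp_rw [h2]
    rw [lintegral_indicator measurableSet_Ioi, lintegral_mul_const _ (by fun_prop), aux_gamma]
  have hG : 0 < Real.Gamma ((n : ℝ) / 2 + 1) := Real.Gamma_pos_of_pos (by positivity)
  rw [integral_eq_lintegral_of_nonneg_ae (Filter.Eventually.of_forall fun s => by positivity)
    (by fun_prop), key, ENNReal.toReal_mul, ENNReal.toReal_ofReal (by positivity), neg_div,
    Real.rpow_neg (by positivity), Real.mul_rpow (by norm_num) pi_pos.le]
  have : (0:ℝ) < 4 ^ ((n:ℝ)/2) := by positivity
  have : (0:ℝ) < π ^ ((n:ℝ)/2) := by positivity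
  field_simp
end

section
/- Let n ≥ 1 and let u : ℝⁿ → ℝ be a continuously differentiable function with compact support. Then ∫_{ℝⁿ} (2n + |x|²) u(x)² e^{|x|²/4} dx ≤ ∫_{ℝⁿ} ( |x|² u(x)² + 4 |∇u(x)|² ) e^{|x|²/4} dx. -/
open Real MeasureTheory RealInnerProductSpace

theorem coord_aux (n : ℕ) (u : EuclideanSpace ℝ (Fin n) → ℝ) (hu : ContDiff ℝ 1 u)
    (hsupp : HasCompactSupport u) (i : Fin n) :
    Integrable (fun x => (2 + (x i) ^ 2) * (u x) ^ 2 * Real.exp (‖x‖ ^ 2 / 4)) ∧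
    Integrable (fun x => ((x i) ^ 2 * (u x) ^ 2 +
      4 * (fderiv ℝ u x (EuclideanSpace.single i 1)) ^ 2) * Real.exp (‖x‖ ^ 2 / 4)) ∧
    ∫ x, (2 + (x i) ^ 2) * (u x) ^ 2 * Real.exp (‖x‖ ^ 2 / 4) ≤
    ∫ x, ((x i) ^ 2 * (u x) ^ 2 +
      4 * (fderiv ℝ u x (EuclideanSpace.single i 1)) ^ 2) * Real.exp (‖x‖ ^ 2 / 4) := by
  set v : EuclideanSpace ℝ (Fin n) := EuclideanSpace.single i 1 with hv
  have hc : Continuous u := hu.continuous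
  have hd : Continuous (fun x => fderiv ℝ u x v) :=
    (hu.continuous_fderiv one_ne_zero).clm_apply continuous_const
  have hds : ∀ x, x ∉ tsupport u → fderiv ℝ u x v = 0 := by
    intro x hx
    have : fderiv ℝ u x = 0 := by
      by_contra h
      exact hx (support_fderiv_subset ℝ h)
    simp [this]
  have hus : ∀ x, x ∉ tsupport u → u x = 0 := fun x hx => image_eq_zero_of_notMem_tsupport hx
  have key : ∀ F : EuclideanSpace ℝ (Fin n) → ℝ, Continuous F →
      (∀ x, u x = 0 → fderiv ℝ u x v = 0 → F x = 0) → Integrable F := by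
    intro F hF h0
    refine hF.integrable_of_hasCompactSupport ?_
    exact HasCompactSupport.intro hsupp (fun x hx => h0 x (hus x hx) (hds x hx))
  have I1 : Integrable (fun x => (2 + (x i) ^ 2) * (u x) ^ 2 * Real.exp (‖x‖ ^ 2 / 4)) :=
    key _ (by fun_prop) (by intro x h1 h2; simp [h1])
  have I2 : Integrable (fun x => ((x i) ^ 2 * (u x) ^ 2 +
      4 * (fderiv ℝ u x v) ^ 2) * Real.exp (‖x‖ ^ 2 / 4)) :=
    key _ (by fun_prop) (by intro x h1 h2; simp [h1, h2])
  have I3 : Integrable (fun x => (2 * u x * fderiv ℝ u x v) * (2 * x i * Real.exp (‖x‖ ^ 2 / 4))) :=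
    key _ (by fun_prop) (by intro x h1 h2; simp [h1])
  refine ⟨I1, I2, ?_⟩
  have ibp := integral_bilinear_hasLineDerivAt_right_eq_neg_left_of_integrable
    (μ := (volume : Measure (EuclideanSpace ℝ (Fin n)))) (B := ContinuousLinearMap.mul ℝ ℝ)
    (v := v) (f := fun x => u x ^ 2) (f' := fun x => 2 * u x * fderiv ℝ u x v)
    (g := fun x => 2 * x i * Real.exp (‖x‖ ^ 2 / 4))
    (g' := fun x => (2 + (x i) ^ 2) * Real.exp (‖x‖ ^ 2 / 4)) (by simpa using I3)
    (by
      simp only [ContinuousLinearMap.mul_apply']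
      exact I1.congr (Filter.Eventually.of_forall fun x => by simp only []; ring))
    (by
      simp only [ContinuousLinearMap.mul_apply']
      exact key _ (by fun_prop) (by intro x h1 h2; simp [h1]))
    (by
      intro x _
      have h := ((hu.differentiable one_ne_zero x).hasFDerivAt.pow 2).hasLineDerivAt v
      convert h using 1
      simp)
    (by
      intro x _
      have h1 : HasFDerivAt (fun x : EuclideanSpace ℝ (Fin n) => x i)
        (EuclideanSpace.proj i : EuclideanSpace ℝ (Fin n) →L[ℝ] ℝ) x :=
        (EuclideanSpace.proj i : EuclideanSpace ℝ (Fin n) →L[ℝ] ℝ).hasFDerivAt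
      have h2 : HasFDerivAt (fun x : EuclideanSpace ℝ (Fin n) => ‖x‖ ^ 2)
        (2 • innerSL ℝ x) x := (hasStrictFDerivAt_norm_sq x).hasFDerivAt
      have h3 := ((h1.const_mul 2).mul ((h2.mul_const (1/4)).exp)).hasLineDerivAt v
      have e : ∀ y : EuclideanSpace ℝ (Fin n), ‖y‖ ^ 2 / 4 = ‖y‖ ^ 2 * (1/4) := fun y => by ring
      simp only [e]
      have e2 : (2 + (x i) ^ 2) * Real.exp (‖x‖ ^ 2 * (1/4)) =
          ((2 * x i) • rexp (‖x‖ ^ 2 * (1 / 4)) • ((1 / 4 : ℝ) • (2 • (innerSL ℝ) x)) +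
          rexp (‖x‖ ^ 2 * (1 / 4)) • ((2 : ℝ) • (EuclideanSpace.proj i :
            EuclideanSpace ℝ (Fin n) →L[ℝ] ℝ))) v := by
        simp [hv, EuclideanSpace.inner_single_right]
        ring
      rw [e2]
      exact h3)
  simp only [ContinuousLinearMap.mul_apply'] at ibp
  have e1 : ∫ x, (2 + (x i) ^ 2) * (u x) ^ 2 * Real.exp (‖x‖ ^ 2 / 4) =
      ∫ x, u x ^ 2 * ((2 + (x i) ^ 2) * Real.exp (‖x‖ ^ 2 / 4)) := by
    congr 1; ext x; ring
  rw [e1, ibp, ← integral_neg]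
  refine integral_mono I3.neg I2 fun x => ?_
  have := mul_nonneg (sq_nonneg (x i * u x + 2 * fderiv ℝ u x v)) (Real.exp_pos (‖x‖ ^ 2 / 4)).le
  simp only [Pi.neg_apply]
  nlinarith [this]

/-- For `u : ℝⁿ → ℝ` of class `C¹` with compact support,
`∫ (2n + |x|²) u² e^(|x|²/4) dx ≤ ∫ (|x|² u² + 4 |∇u|²) e^(|x|²/4) dx`. -/
theorem stmt_5 (n : ℕ) (hn : 1 ≤ n)
    (u : EuclideanSpace ℝ (Fin n) → ℝ) (hu : ContDiff ℝ 1 u)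
    (hsupp : HasCompactSupport u) :
    ∫ x, (2 * n + ‖x‖ ^ 2) * (u x) ^ 2 * Real.exp (‖x‖ ^ 2 / 4)
      ≤ ∫ x, (‖x‖ ^ 2 * (u x) ^ 2 + 4 * ‖gradient u x‖ ^ 2) * Real.exp (‖x‖ ^ 2 / 4) := by
  have H := coord_aux n u hu hsupp
  have hs := Finset.sum_le_sum (fun i (_ : i ∈ Finset.univ) => (H i).2.2)
  rw [← integral_finsetSum _ (fun i _ => (H i).1),
    ← integral_finsetSum _ (fun i _ => (H i).2.1)] at hs
  have hN : ∀ y : EuclideanSpace ℝ (Fin n), ‖y‖ ^ 2 = ∑ i, y i ^ 2 := fun y =>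
    EuclideanSpace.real_norm_sq_eq y
  have hG : ∀ x i, gradient u x i = fderiv ℝ u x (EuclideanSpace.single i 1) := by
    intro x i
    have h : ⟪gradient u x, EuclideanSpace.single i (1:ℝ)⟫
        = fderiv ℝ u x (EuclideanSpace.single i 1) := by
      simp only [gradient, InnerProductSpace.toDual_symm_apply]
    rw [← h, EuclideanSpace.inner_single_right]
    simp
  refine (le_of_eq ?_).trans (hs.trans (le_of_eq ?_))
  · congr 1; ext x
    rw [← Finset.sum_mul, ← Finset.sum_mul, Finset.sum_add_distrib, ← hN]
    simp [mul_comm]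
  · congr 1; ext x
    rw [← Finset.sum_mul, Finset.sum_add_distrib, ← Finset.sum_mul, ← hN, ← Finset.mul_sum,
      hN (gradient u x)]
    simp only [hG]
end

section
/- Let n ≥ 1 and let u : ℝⁿ → ℝ be a continuously differentiable function with compact support. Then (n/2) ∫_{ℝⁿ} u(x)² e^{|x|²/4} dx ≤ ∫_{ℝⁿ} |∇u(x)|² e^{|x|²/4} dx. -/
open Real MeasureTheory

lemma stmt_6_coord (n : ℕ)
    (u : EuclideanSpace ℝ (Fin n) → ℝ) (hu : ContDiff ℝ 1 u)
    (hsupp : HasCompactSupport u) (i : Fin n) :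
    Integrable (fun x => (u x) ^ 2 * Real.exp (‖x‖ ^ 2 / 4)) ∧
    Integrable (fun x => (gradient u x i) ^ 2 * Real.exp (‖x‖ ^ 2 / 4)) ∧
    (1 / 2 : ℝ) * ∫ x, (u x) ^ 2 * Real.exp (‖x‖ ^ 2 / 4)
      ≤ ∫ x, (gradient u x i) ^ 2 * Real.exp (‖x‖ ^ 2 / 4) := by
  set v : EuclideanSpace ℝ (Fin n) := EuclideanSpace.single i 1 with hv
  have hgrad : ∀ x, gradient u x i = fderiv ℝ u x v := by
    intro x
    have h1 : inner ℝ (gradient u x) v = fderiv ℝ u x v := by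
      simp [gradient]
    rw [← h1, hv, EuclideanSpace.inner_single_right]
    simp
  simp_rw [hgrad]
  have hdu : Continuous (fun x => fderiv ℝ u x v) :=
    (hu.continuous_fderiv (by norm_num)).clm_apply continuous_const
  have hdus : HasCompactSupport (fun x => fderiv ℝ u x v) := by
    apply (hsupp.fderiv (𝕜 := ℝ)).mono
    intro x hx h
    apply hx
    simp [h]
  have huc := hu.continuous
  have hxi : Continuous (fun x : EuclideanSpace ℝ (Fin n) => x i) := by fun_prop
  have int_of : ∀ w : EuclideanSpace ℝ (Fin n) → ℝ, Continuous w →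
      (∀ x, u x = 0 → fderiv ℝ u x v = 0 → w x = 0) → Integrable w := by
    intro w hw h0
    apply hw.integrable_of_hasCompactSupport
    apply HasCompactSupport.intro (K := tsupport u ∪ tsupport (fun x => fderiv ℝ u x v))
    · exact IsCompact.union hsupp hdus
    · intro x hx
      rw [Set.mem_union, not_or] at hx
      exact h0 x (image_eq_zero_of_notMem_tsupport hx.1)
        (image_eq_zero_of_notMem_tsupport (f := fun x => fderiv ℝ u x v) hx.2)
  have I1 : Integrable (fun x => (u x) ^ 2 * Real.exp (‖x‖ ^ 2 / 4)) :=
    int_of _ (by fun_prop) (by intro x h _; simp [h])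
  have I2 : Integrable (fun x => (fderiv ℝ u x v) ^ 2 * Real.exp (‖x‖ ^ 2 / 4)) :=
    int_of _ (by fun_prop) (by intro x _ h; simp [h])
  refine ⟨I1, I2, ?_⟩
  let G : EuclideanSpace ℝ (Fin n) → ℝ := fun x =>
    (u x) ^ 2 * Real.exp (‖x‖ ^ 2 / 4) + 2 * x i * u x * fderiv ℝ u x v * Real.exp (‖x‖ ^ 2 / 4)
      + (x i) ^ 2 / 2 * (u x) ^ 2 * Real.exp (‖x‖ ^ 2 / 4)
  have IG : Integrable G :=
    int_of _ (by unfold G; fun_prop) (by intro x h _; simp [G, h])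
  let F : EuclideanSpace ℝ (Fin n) → ℝ := fun x => x i * ((u x) ^ 2 * Real.exp (‖x‖ ^ 2 / 4))
  have hF : ∀ x, DifferentiableAt ℝ F x ∧ fderiv ℝ F x v = G x := by
    intro x
    have a1 : HasFDerivAt (fun x : EuclideanSpace ℝ (Fin n) => x i)
        (EuclideanSpace.proj i : EuclideanSpace ℝ (Fin n) →L[ℝ] ℝ) x :=
      (EuclideanSpace.proj i : EuclideanSpace ℝ (Fin n) →L[ℝ] ℝ).hasFDerivAt
    have a2 := ((hu.differentiable (by norm_num)) x).hasFDerivAt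
    have a3 := ((hasStrictFDerivAt_norm_sq x).hasFDerivAt.mul_const (4:ℝ)⁻¹).exp
    have a4 := a1.mul ((a2.pow 2).mul a3)
    have e : F = _ := rfl
    have a5 : HasFDerivAt F _ x := a4
    refine ⟨a5.differentiableAt, ?_⟩
    rw [a5.fderiv]
    simp [G, hv, EuclideanSpace.inner_single_right, div_eq_mul_inv]
    ring
  have hz : ∫ x, G x = 0 := by
    have := integral_mul_fderiv_eq_neg_fderiv_mul_of_integrable
      (μ := (volume : Measure (EuclideanSpace ℝ (Fin n)))) (f := fun _ => (1:ℝ)) (g := F) (v := v)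
      (by simp) (by simpa [(hF _).2] using IG)
      (by simpa using int_of F (by unfold F; fun_prop) (by intro x h _; simp [F, h]))
      (by intro x _; fun_prop) (fun x _ => (hF x).1)
    simpa [(hF _).2] using this
  have hnn : 0 ≤ ∫ x, (fderiv ℝ u x v + x i * u x / 2) ^ 2 * Real.exp (‖x‖ ^ 2 / 4) :=
    integral_nonneg fun x => by positivity
  have key : ∫ x, (fderiv ℝ u x v + x i * u x / 2) ^ 2 * Real.exp (‖x‖ ^ 2 / 4)
      = ∫ x, ((fderiv ℝ u x v) ^ 2 * Real.exp (‖x‖ ^ 2 / 4)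
        - (1/2) * ((u x) ^ 2 * Real.exp (‖x‖ ^ 2 / 4)) + (1/2) * G x) := by
    congr 1
    ext x
    simp only [G]
    ring
  have I3 : Integrable (fun x => (fderiv ℝ u x v) ^ 2 * Real.exp (‖x‖ ^ 2 / 4)
        - (1/2) * ((u x) ^ 2 * Real.exp (‖x‖ ^ 2 / 4))) := I2.sub (I1.const_mul _)
  rw [integral_add I3 (IG.const_mul _), integral_sub I2 (I1.const_mul _),
    integral_const_mul, integral_const_mul, hz] at key
  linarith

/-- Weighted Poincaré inequality: for `u : ℝⁿ → ℝ` of class `C¹` with compact support,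
`(n/2) ∫ u² e^(|x|²/4) dx ≤ ∫ |∇u|² e^(|x|²/4) dx`. -/
theorem stmt_6 (n : ℕ) (hn : 1 ≤ n)
    (u : EuclideanSpace ℝ (Fin n) → ℝ) (hu : ContDiff ℝ 1 u)
    (hsupp : HasCompactSupport u) :
    (n / 2 : ℝ) * ∫ x, (u x) ^ 2 * Real.exp (‖x‖ ^ 2 / 4)
      ≤ ∫ x, ‖gradient u x‖ ^ 2 * Real.exp (‖x‖ ^ 2 / 4) := by
  have h := stmt_6_coord n u hu hsupp
  have e : ∫ x, ‖gradient u x‖ ^ 2 * Real.exp (‖x‖ ^ 2 / 4)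
      = ∑ i, ∫ x, (gradient u x i) ^ 2 * Real.exp (‖x‖ ^ 2 / 4) := by
    rw [← integral_finsetSum _ (fun i _ => (h i).2.1)]
    congr 1
    ext x
    rw [EuclideanSpace.norm_sq_eq, Finset.sum_mul]
    simp
  rw [e]
  have := Finset.sum_le_sum (s := Finset.univ) (fun i _ => (h i).2.2)
  refine le_trans (le_of_eq ?_) this
  simp
  ring
end

section
/- Let n ≥ 1 and let u : ℝⁿ → ℝ be a smooth function with compact support that is not identically zero. Then the inequality is strict: (n/2) ∫_{ℝⁿ} u(x)² e^{|x|²/4} dx < ∫_{ℝⁿ} |∇u(x)|² e^{|x|²/4} dx. Equivalently, ∫_{ℝⁿ} [ |∇u(x)|² + (1/2 - (n+1)/2) u(x)² ] e^{|x|²/4} dx > 0. -/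
open Real MeasureTheory

lemma aux_div (n : ℕ) (f : EuclideanSpace ℝ (Fin n) → ℝ) (hf : ContDiff ℝ 1 f)
    (hs : HasCompactSupport f) :
    ∫ x, fderiv ℝ f x x = - (n : ℝ) * ∫ x, f x := by
  have hc' : Continuous (fderiv ℝ f) := hf.continuous_fderiv (by norm_num)
  have hs' : HasCompactSupport (fderiv ℝ f) := hs.fderiv ℝ
  let p : Fin n → EuclideanSpace ℝ (Fin n) →L[ℝ] ℝ := fun i => EuclideanSpace.proj i
  let e : Fin n → EuclideanSpace ℝ (Fin n) := fun i => EuclideanSpace.single i 1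
  have hpe : ∀ i, p i (e i) = 1 := by intro i; simp [p, e]
  have hI : ∀ i, Integrable (fun x => fderiv ℝ f x (e i) * p i x) := by
    intro i
    apply Continuous.integrable_of_hasCompactSupport
    · fun_prop
    · refine hs'.mono ?_
      intro x hx h0
      apply hx
      simp [h0]
  have hfI : Integrable f := hf.continuous.integrable_of_hasCompactSupport hs
  have h1 : ∀ i, ∫ x, fderiv ℝ f x (e i) * p i x = - ∫ x, f x := by
    intro i
    have := integral_mul_fderiv_eq_neg_fderiv_mul_of_integrable (μ := volume) (f := f) (g := p i)
      (v := e i) (hI i) (by simpa [hpe] using hfI)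
      (by
        apply Continuous.integrable_of_hasCompactSupport
        · have := hf.continuous
          fun_prop
        · exact hs.mul_right)
      (fun x _ => hf.differentiable (by norm_num) x) (fun x _ => (p i).differentiableAt)
    simp only [ContinuousLinearMap.fderiv, hpe, mul_one] at this
    linarith
  have h2 : ∀ x, fderiv ℝ f x x = ∑ i, fderiv ℝ f x (e i) * p i x := by
    intro x
    have hx : x = ∑ i, (x i) • e i := by
      ext j
      simp [e, Pi.single_apply]
    conv_lhs => rw [hx]
    rw [← hx, hx, map_sum]
    rw [← hx]
    exact Finset.sum_congr rfl fun i _ => by simp [p, mul_comm]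
  simp_rw [h2]
  rw [integral_finset_sum _ (fun i _ => hI i)]
  simp [h1]

theorem stmt_7 (n : ℕ) (hn : 1 ≤ n)
    (u : EuclideanSpace ℝ (Fin n) → ℝ) (hu : ContDiff ℝ (⊤ : ℕ∞) u)
    (hsupp : HasCompactSupport u) (hne : u ≠ 0) :
    (n / 2 : ℝ) * ∫ x, (u x) ^ 2 * Real.exp (‖x‖ ^ 2 / 4)
        < ∫ x, ‖gradient u x‖ ^ 2 * Real.exp (‖x‖ ^ 2 / 4)
    ∧ 0 < ∫ x, (‖gradient u x‖ ^ 2 + (1 / 2 - (n + 1) / 2) * (u x) ^ 2)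
        * Real.exp (‖x‖ ^ 2 / 4) := by
  have hu1 : ContDiff ℝ 1 u := hu.of_le (by exact_mod_cast le_top)
  have huc := hu1.continuous
  have hud : Differentiable ℝ u := hu1.differentiable (by norm_num)
  have hu' : Continuous (fderiv ℝ u) := hu1.continuous_fderiv (by norm_num)
  have hs' : HasCompactSupport (fderiv ℝ u) := hsupp.fderiv ℝ
  have hg : Continuous (gradient u) := by
    unfold gradient
    exact (LinearIsometryEquiv.continuous _).comp hu'
  have hgs : HasCompactSupport (gradient u) := by
    refine hs'.mono ?_
    intro x hx h0
    apply hx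
    simp [gradient, h0]
  have hE : ∀ x : EuclideanSpace ℝ (Fin n), HasFDerivAt (fun x => Real.exp (‖x‖ ^ 2 / 4))
      ((Real.exp (‖x‖ ^ 2 / 4) / 2) • innerSL ℝ x) x := by
    intro x
    have h := (((hasStrictFDerivAt_norm_sq x).hasFDerivAt).mul_const (1/4 : ℝ)).exp
    have e1 : ∀ y : EuclideanSpace ℝ (Fin n), ‖y‖ ^ 2 / 4 = ‖y‖ ^ 2 * (1/4) := fun y => by ring
    simp_rw [e1]
    refine h.congr_fderiv ?_
    ext y
    simp
    ring
  have hEc : ContDiff ℝ 1 (fun x : EuclideanSpace ℝ (Fin n) => Real.exp (‖x‖ ^ 2 / 4)) :=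
    ((contDiff_norm_sq ℝ).div_const 4).exp
  have hEcc := hEc.continuous
  have key := aux_div n (fun x => (u x) ^ 2 * Real.exp (‖x‖ ^ 2 / 4)) ((hu1.pow 2).mul hEc)
    (by
      refine hsupp.mono ?_
      intro x hx h0
      apply hx
      simp [h0])
  have hfd : ∀ x, fderiv ℝ (fun x => (u x) ^ 2 * Real.exp (‖x‖ ^ 2 / 4)) x x
      = (2 * u x * fderiv ℝ u x x + (u x) ^ 2 * ‖x‖ ^ 2 / 2) * Real.exp (‖x‖ ^ 2 / 4) := by
    intro x
    have h := (((hud x).hasFDerivAt.pow 2).mul (hE x)).fderiv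
    have h' := congrArg (fun L => L x) h
    refine h'.trans ?_
    simp
    ring
  simp_rw [hfd] at key
  have hin : ∀ x y, inner ℝ (gradient u x) y = fderiv ℝ u x y := by
    intro x y
    simp [gradient]
  have hpt : ∀ x, ‖gradient u x + (u x / 2) • x‖ ^ 2 * Real.exp (‖x‖ ^ 2 / 4)
      = ‖gradient u x‖ ^ 2 * Real.exp (‖x‖ ^ 2 / 4) + 1 / 2 *
      ((2 * u x * fderiv ℝ u x x + (u x) ^ 2 * ‖x‖ ^ 2 / 2) * Real.exp (‖x‖ ^ 2 / 4)) := by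
    intro x
    rw [norm_add_sq_real, inner_smul_right, hin, norm_smul, mul_pow, Real.norm_eq_abs, sq_abs]
    ring
  have hI1 : Integrable (fun x => ‖gradient u x‖ ^ 2 * Real.exp (‖x‖ ^ 2 / 4)) := by
    apply Continuous.integrable_of_hasCompactSupport
    · fun_prop
    · refine hgs.mono ?_
      intro x hx h0
      apply hx
      simp [h0]
  have hI0 : Integrable (fun x => (u x) ^ 2 * Real.exp (‖x‖ ^ 2 / 4)) := by
    apply Continuous.integrable_of_hasCompactSupport
    · fun_prop
    · refine hsupp.mono ?_
      intro x hx h0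
      apply hx
      simp [h0]
  have hI2 : Integrable (fun x => (2 * u x * fderiv ℝ u x x + (u x) ^ 2 * ‖x‖ ^ 2 / 2)
      * Real.exp (‖x‖ ^ 2 / 4)) := by
    apply Continuous.integrable_of_hasCompactSupport
    · fun_prop
    · refine hsupp.mono ?_
      intro x hx h0
      apply hx
      simp [h0]
  have hpos : 0 < ∫ x, ‖gradient u x + (u x / 2) • x‖ ^ 2 * Real.exp (‖x‖ ^ 2 / 4) := by
    have hex : ∃ x, gradient u x + (u x / 2) • x ≠ 0 := by
      by_contra! hz
      have hv : ∀ x, HasFDerivAt (fun x => u x * Real.exp (‖x‖ ^ 2 / 4))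
          (0 : EuclideanSpace ℝ (Fin n) →L[ℝ] ℝ) x := by
        intro x
        refine ((hud x).hasFDerivAt.mul (hE x)).congr_fderiv ?_
        ext y
        have h := congrArg (fun z => inner ℝ z y) (hz x)
        simp only [inner_add_left, hin, inner_smul_left, inner_zero_left] at h
        simp at h ⊢
        linear_combination Real.exp (‖x‖ ^ 2 / 4) * h
      have hconst := is_const_of_fderiv_eq_zero (𝕜 := ℝ) (fun x => (hv x).differentiableAt)
        (fun x => (hv x).fderiv)
      haveI : Nonempty (Fin n) := ⟨⟨0, hn⟩⟩
      haveI : Nontrivial (EuclideanSpace ℝ (Fin n)) := inferInstance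
      haveI : NoncompactSpace (EuclideanSpace ℝ (Fin n)) := NormedSpace.noncompactSpace ℝ _
      obtain ⟨z, hz0⟩ : ∃ z, u z = 0 := by
        by_contra! h
        have : tsupport u = Set.univ := by
          rw [Set.eq_univ_iff_forall]
          exact fun x => subset_tsupport u (h x)
        have hc : IsCompact (tsupport u) := hsupp
        rw [this] at hc
        exact noncompact_univ _ hc
      apply hne
      ext x
      have := hconst x z
      simp only [hz0, zero_mul, mul_eq_zero, (Real.exp_pos _).ne', or_false] at this
      exact this
    obtain ⟨x0, hx0⟩ := hex
    refine Continuous.integral_pos_of_hasCompactSupport_nonneg_nonzero (x := x0) ?_ ?_ ?_ ?_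
    · fun_prop
    · refine (hgs.add (hsupp.smul_right (f' := fun x => (1/2 : ℝ) • x))).mono ?_
      intro x hx h0
      apply hx
      have : gradient u x + (u x / 2) • x = 0 := by
        rw [← h0]
        simp [smul_smul, div_eq_mul_inv]
      simp [this]
    · intro x
      positivity
    · have := norm_pos_iff.mpr hx0
      positivity
  simp_rw [hpt] at hpos
  rw [integral_add hI1 (hI2.const_mul _), integral_const_mul, key] at hpos
  refine ⟨by linarith, ?_⟩
  have e2 : ∀ x, (‖gradient u x‖ ^ 2 + (1 / 2 - ((n : ℝ) + 1) / 2) * (u x) ^ 2)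
        * Real.exp (‖x‖ ^ 2 / 4) = ‖gradient u x‖ ^ 2 * Real.exp (‖x‖ ^ 2 / 4)
        + (-(n : ℝ) / 2) * ((u x) ^ 2 * Real.exp (‖x‖ ^ 2 / 4)) := fun x => by ring
  simp_rw [e2]
  rw [integral_add hI1 (hI0.const_mul _), integral_const_mul]
  linarith
end
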